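/- There exists an absolute constant C > 0 with the following property: if Y₁, Y₂, … are identically distributed real random variables with E(Y₁) = 0 and E(Y₁⁴) < ∞ which form a one-dependent sequence (i.e., for every m ≥ 1 the σ-algebras σ(Y₁, …, Y_m) and σ(Y_{m+2}, Y_{m+3}, …) are independent), then for every r ≥ 1, E( (Σ_{k=1}^r Y_k)⁴ ) ≤ C r² E(Y₁⁴). -/

import Mathlib

open MeasureTheory ProbabilityTheory

lemma MeasureTheory.MemLp.integrable_pow_le {Ω : Type*} [MeasurableSpace Ω] {P : Measure Ω}
    [IsFiniteMeasure P] {f : Ω → ℝ} {n : ℕ} (hf : MemLp f n P) {k : ℕ} (hk : k ≤ n) :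
    Integrable (fun ω => f ω ^ k) P := by
  have h : MemLp f k P := hf.mono_exponent (by exact_mod_cast hk)
  refine h.integrable_norm_pow'.mono (h.aestronglyMeasurable.pow k) (ae_of_all _ fun ω => ?_)
  simp

lemma sq_integral_le_integral_sq {Ω : Type*} [MeasurableSpace Ω] {P : Measure Ω}
    [IsProbabilityMeasure P] {f : Ω → ℝ} (hf : MemLp f 2 P) :
    (∫ ω, f ω ∂P) ^ 2 ≤ ∫ ω, f ω ^ 2 ∂P := by
  have h := variance_nonneg f P
  rw [variance_eq_sub hf] at h
  simpa using h

section

variable {Ω : Type*} [MeasurableSpace Ω] {P : Measure Ω} [IsProbabilityMeasure P] {S X : Ω → ℝ}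

lemma ProbabilityTheory.IndepFun.integral_pow_mul_pow (hind : IndepFun S X P)
    (hS : MemLp S 4 P) (hX : MemLp X 4 P) {i j : ℕ} (hi : i ≤ 4) (hj : j ≤ 4) :
    Integrable (fun ω => S ω ^ i * X ω ^ j) P ∧
      ∫ ω, S ω ^ i * X ω ^ j ∂P = (∫ ω, S ω ^ i ∂P) * ∫ ω, X ω ^ j ∂P := by
  have h : IndepFun (fun ω => S ω ^ i) (fun ω => X ω ^ j) P :=
    hind.comp (measurable_id.pow_const i) (measurable_id.pow_const j)
  have hSi := hS.integrable_pow_le (n := 4) hi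
  have hXj := hX.integrable_pow_le (n := 4) hj
  exact ⟨h.integrable_mul hSi hXj,
    h.integral_fun_mul_eq_mul_integral hSi.aestronglyMeasurable hXj.aestronglyMeasurable⟩

lemma ProbabilityTheory.IndepFun.integral_add_sq (hind : IndepFun S X P)
    (hS : MemLp S 4 P) (hX : MemLp X 4 P) (hX0 : ∫ ω, X ω ∂P = 0) :
    ∫ ω, (S ω + X ω) ^ 2 ∂P = ∫ ω, S ω ^ 2 ∂P + ∫ ω, X ω ^ 2 ∂P := by
  have h1 := hind.integral_pow_mul_pow hS hX (i := 1) (j := 1) (by norm_num) (by norm_num)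
  have hS2 := hS.integrable_pow_le (n := 4) (k := 2) (by norm_num)
  have hX2 := hX.integrable_pow_le (n := 4) (k := 2) (by norm_num)
  calc ∫ ω, (S ω + X ω) ^ 2 ∂P
      = ∫ ω, (S ω ^ 2 + 2 * (S ω ^ 1 * X ω ^ 1) + X ω ^ 2) ∂P := by
        congr 1; ext ω; ring
    _ = _ := by
        rw [integral_add (hS2.fun_add (h1.1.const_mul 2)) hX2,
          integral_add hS2 (h1.1.const_mul 2), integral_const_mul, h1.2]
        simp [hX0]

lemma ProbabilityTheory.IndepFun.integral_add_pow_four (hind : IndepFun S X P)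
    (hS : MemLp S 4 P) (hX : MemLp X 4 P) (hS0 : ∫ ω, S ω ∂P = 0) (hX0 : ∫ ω, X ω ∂P = 0) :
    ∫ ω, (S ω + X ω) ^ 4 ∂P = ∫ ω, S ω ^ 4 ∂P
      + 6 * ((∫ ω, S ω ^ 2 ∂P) * ∫ ω, X ω ^ 2 ∂P) + ∫ ω, X ω ^ 4 ∂P := by
  have h31 := hind.integral_pow_mul_pow hS hX (i := 3) (j := 1) (by norm_num) (by norm_num)
  have h22 := hind.integral_pow_mul_pow hS hX (i := 2) (j := 2) (by norm_num) (by norm_num)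
  have h13 := hind.integral_pow_mul_pow hS hX (i := 1) (j := 3) (by norm_num) (by norm_num)
  have hS4 := hS.integrable_pow_le (n := 4) le_rfl
  have hX4 := hX.integrable_pow_le (n := 4) le_rfl
  calc ∫ ω, (S ω + X ω) ^ 4 ∂P
      = ∫ ω, (S ω ^ 4 + 4 * (S ω ^ 3 * X ω ^ 1) + 6 * (S ω ^ 2 * X ω ^ 2)
          + 4 * (S ω ^ 1 * X ω ^ 3) + X ω ^ 4) ∂P := by
        congr 1; ext ω; ring
    _ = _ := by
        rw [integral_add (((hS4.fun_add (h31.1.const_mul 4)).fun_add (h22.1.const_mul 6)).fun_add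
            (h13.1.const_mul 4)) hX4,
          integral_add ((hS4.fun_add (h31.1.const_mul 4)).fun_add (h22.1.const_mul 6))
            (h13.1.const_mul 4),
          integral_add (hS4.fun_add (h31.1.const_mul 4)) (h22.1.const_mul 6),
          integral_add hS4 (h31.1.const_mul 4), integral_const_mul, integral_const_mul,
          integral_const_mul, h31.2, h22.2, h13.2]
        simp [hX0, hS0]

/-- Fourth-moment bound for partial sums of centred variables, each independent of the sum of
its predecessors. -/
lemma integral_sum_range_pow_four_le {X : ℕ → Ω → ℝ} {M : ℝ} (hX : ∀ k, MemLp (X k) 4 P)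
    (hX0 : ∀ k, ∫ ω, X k ω ∂P = 0) (hX4 : ∀ k, ∫ ω, X k ω ^ 4 ∂P = M)
    (hind : ∀ k, 1 ≤ k → IndepFun (fun ω => ∑ i ∈ Finset.range k, X i ω) (X k) P) (n : ℕ) :
    ∫ ω, (∑ k ∈ Finset.range n, X k ω) ^ 4 ∂P ≤ 3 * (n : ℝ) ^ 2 * M := by
  have hM : 0 ≤ M := hX4 0 ▸ integral_nonneg fun ω => by positivity
  have hX2 (k : ℕ) : ∫ ω, X k ω ^ 2 ∂P ≤ √M := by
    refine Real.le_sqrt_of_sq_le ?_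
    have hm : MemLp (fun ω => X k ω ^ 2) 2 P := by
      refine (memLp_two_iff_integrable_sq ((hX k).aestronglyMeasurable.pow 2)).2 ?_
      simpa [← pow_mul] using (hX k).integrable_pow_le (n := 4) le_rfl
    simpa [← pow_mul, hX4] using sq_integral_le_integral_sq hm
  have hS (n : ℕ) : MemLp (fun ω => ∑ k ∈ Finset.range n, X k ω) 4 P :=
    memLp_finsetSum _ fun k _ => hX k
  have hS0 (n : ℕ) : ∫ ω, ∑ k ∈ Finset.range n, X k ω ∂P = 0 := by
    rw [integral_finsetSum _ fun k _ => (hX k).integrable (by norm_num)]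
    simp [hX0]
  have hind' (k : ℕ) : IndepFun (fun ω => ∑ i ∈ Finset.range k, X i ω) (X k) P := by
    rcases k with _ | k
    · simpa using indepFun_const_left (0 : ℝ) (X 0)
    · exact hind _ (by omega)
  have hS2 (n : ℕ) : ∫ ω, (∑ k ∈ Finset.range n, X k ω) ^ 2 ∂P ≤ n * √M := by
    induction n with
    | zero => simp
    | succ n ih =>
      simp_rw [Finset.sum_range_succ]
      rw [(hind' n).integral_add_sq (hS n) (hX n) (hX0 n)]
      push_cast
      linarith [hX2 n]
  induction n with
  | zero => simp
  | succ n ih =>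
    simp_rw [Finset.sum_range_succ]
    rw [(hind' n).integral_add_pow_four (hS n) (hX n) (hS0 n) (hX0 n), hX4]
    have h : (∫ ω, (∑ k ∈ Finset.range n, X k ω) ^ 2 ∂P) * ∫ ω, X n ω ^ 2 ∂P ≤ n * √M * √M :=
      mul_le_mul (hS2 n) (hX2 n) (integral_nonneg fun ω => by positivity) (by positivity)
    rw [mul_assoc, Real.mul_self_sqrt hM] at h
    push_cast
    linarith

end

lemma sum_range_eq_sum_even_add_sum_odd {M : Type*} [AddCommMonoid M] (f : ℕ → M) (r : ℕ) :
    ∑ k ∈ Finset.range r, f k =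
      ∑ k ∈ Finset.range ((r + 1) / 2), f (2 * k) + ∑ k ∈ Finset.range (r / 2), f (2 * k + 1) := by
  induction r with
  | zero => simp
  | succ r ih =>
    rw [Finset.sum_range_succ, ih]
    rcases Nat.even_or_odd' r with ⟨m, rfl | rfl⟩
    · rw [show (2 * m + 1) / 2 = m by omega, show 2 * m / 2 = m by omega,
        show (2 * m + 1 + 1) / 2 = m + 1 by omega, Finset.sum_range_succ]
      exact add_right_comm _ _ _
    · rw [show (2 * m + 1 + 1) / 2 = m + 1 by omega, show (2 * m + 1) / 2 = m by omega,
        show (2 * m + 1 + 1 + 1) / 2 = m + 1 by omega, Finset.sum_range_succ _ m,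
        Finset.sum_range_succ (fun k => f (2 * k + 1)) m]
      exact add_assoc _ _ _

lemma add_pow_four_le (a b : ℝ) : (a + b) ^ 4 ≤ 8 * (a ^ 4 + b ^ 4) := by
  nlinarith [sq_nonneg (a - b), sq_nonneg (a + b), sq_nonneg (a ^ 2 - b ^ 2),
    mul_nonneg (sq_nonneg (a - b)) (sq_nonneg (a + b)), sq_nonneg ((a - b) ^ 2)]

/-- There is an absolute constant `C > 0` such that whenever
`Y₁, Y₂, …` are identically distributed real random variables with `E Y₁ = 0` and
`E Y₁⁴ < ∞` forming a one-dependent sequence (for every `m ≥ 1`, the σ-algebra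
`σ(Y₁, …, Y_m)` is independent of `σ(Y_{m+2}, Y_{m+3}, …)`), then for every `r ≥ 1`,
`E ((Σ_{k=1}^r Y_k)⁴) ≤ C r² E (Y₁⁴)`.  (Indices are written `0`-based: `Y i`
stands for `Y_{i+1}`.) -/
theorem one_dependent_fourth_moment_bound :
    ∃ C : ℝ, 0 < C ∧
      ∀ (Ω : Type) (_ : MeasurableSpace Ω) (P : Measure Ω),
        IsProbabilityMeasure P →
        ∀ Y : ℕ → Ω → ℝ,
          (∀ k, Measurable (Y k)) →
          (∀ k, Measure.map (Y k) P = Measure.map (Y 0) P) →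
          ∫ ω, Y 0 ω ∂P = 0 →
          Integrable (fun ω => Y 0 ω ^ 4) P →
          (∀ m : ℕ, 1 ≤ m →
            Indep (⨆ i ∈ Set.Iio m, MeasurableSpace.comap (Y i) inferInstance)
              (⨆ i ∈ Set.Ici (m + 1), MeasurableSpace.comap (Y i) inferInstance) P) →
          ∀ r : ℕ, 1 ≤ r →
            ∫ ω, (∑ k ∈ Finset.range r, Y k ω) ^ 4 ∂P ≤
              C * (r : ℝ) ^ 2 * ∫ ω, Y 0 ω ^ 4 ∂P := by
  refine ⟨48, by norm_num, fun Ω _ P _ Y hY hmap h0 h4 hdep r _ => ?_⟩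
  have hid (k : ℕ) : IdentDistrib (Y k) (Y 0) P P :=
    ⟨(hY k).aemeasurable, (hY 0).aemeasurable, hmap k⟩
  have hY0 : MemLp (Y 0) 4 P := by
    refine (integrable_norm_rpow_iff (hY 0).aestronglyMeasurable (by norm_num) (by norm_num)).1 ?_
    refine h4.congr (ae_of_all _ fun ω => ?_)
    simpa using (Even.pow_abs (by decide : Even 4) (Y 0 ω)).symm
  have hLp (k : ℕ) : MemLp (Y k) 4 P := (hid k).symm.memLp_snd hY0
  have hmean (k : ℕ) : ∫ ω, Y k ω ∂P = 0 := (hid k).integral_eq.trans h0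
  have hM (k : ℕ) : ∫ ω, Y k ω ^ 4 ∂P = ∫ ω, Y 0 ω ^ 4 ∂P :=
    ((hid k).comp (measurable_id.pow_const 4)).integral_eq
  have hind (c k : ℕ) (hk : 1 ≤ k) :
      IndepFun (fun ω => ∑ i ∈ Finset.range k, Y (2 * i + c) ω) (Y (2 * k + c)) P := by
    have h := hdep (2 * k + c - 1) (by omega)
    rw [IndepFun_iff_Indep]
    refine indep_of_indep_of_le h (measurable_iff_comap_le.1 ?_) ?_
    · refine Finset.measurable_sum _ fun i hi => measurable_iff_comap_le.2 ?_
      have := Finset.mem_range.1 hi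
      exact le_iSup₂_of_le (2 * i + c) (Set.mem_Iio.2 (by omega)) le_rfl
    · exact le_iSup₂_of_le (2 * k + c) (Set.mem_Ici.2 (by omega)) le_rfl
  have hbound (c n : ℕ) (hn : n ≤ r) :
      ∫ ω, (∑ k ∈ Finset.range n, Y (2 * k + c) ω) ^ 4 ∂P ≤
        3 * (r : ℝ) ^ 2 * ∫ ω, Y 0 ω ^ 4 ∂P := by
    refine (integral_sum_range_pow_four_le (X := fun k => Y (2 * k + c)) (fun k => hLp _)
      (fun k => hmean _) (fun k => hM _) (hind c) n).trans ?_
    have : 0 ≤ ∫ ω, Y 0 ω ^ 4 ∂P := integral_nonneg fun ω => by positivity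
    gcongr
  have hint (c n : ℕ) :
      Integrable (fun ω => (∑ k ∈ Finset.range n, Y (2 * k + c) ω) ^ 4) P :=
    (memLp_finsetSum _ fun k _ => hLp (2 * k + c)).integrable_pow_le (n := 4) le_rfl
  have hsplit (ω : Ω) := sum_range_eq_sum_even_add_sum_odd (fun k => Y k ω) r
  have hE := hbound 0 ((r + 1) / 2) (by omega)
  have hO := hbound 1 (r / 2) (by omega)
  calc ∫ ω, (∑ k ∈ Finset.range r, Y k ω) ^ 4 ∂P
      ≤ ∫ ω, 8 * ((∑ k ∈ Finset.range ((r + 1) / 2), Y (2 * k + 0) ω) ^ 4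
          + (∑ k ∈ Finset.range (r / 2), Y (2 * k + 1) ω) ^ 4) ∂P := by
        refine integral_mono ((memLp_finsetSum _ fun k _ => hLp k).integrable_pow_le
          (n := 4) le_rfl) (((hint _ _).add (hint _ _)).const_mul 8) fun ω => ?_
        simp only [hsplit]
        exact add_pow_four_le _ _
    _ ≤ 48 * (r : ℝ) ^ 2 * ∫ ω, Y 0 ω ^ 4 ∂P := by
        rw [integral_const_mul, integral_add (hint _ _) (hint _ _)]
        linarith
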